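/- There are absolute constants C > 0 and m₀ such that for all integers m ≥ m₀ and 4 ≤ t ≤ m − 4, setting N = C(m, t), if n ≥ C·N·log N and (X, Σ) is a random t-sparse set system with |X| = n and |Σ| = m, then with probability at least 1 − 1/N one has disc(Σ) ≤ 2. -/

import Mathlib

open Finset

open scoped Classical

/-- The discrepancy of a set system `S : Fin m → Finset (Fin n)`. -/
noncomputable def disc {n m : ℕ} (S : Fin m → Finset (Fin n)) : ℕ :=
  sInf {d : ℕ | ∃ χ : Fin n → ℤ, (∀ x, χ x = 1 ∨ χ x = -1) ∧
    ∀ i : Fin m, (∑ x ∈ S i, χ x).natAbs ≤ d}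

/-- The hereditary discrepancy: the maximum of `disc` over restrictions to `Y ⊆ X`. -/
noncomputable def herdisc {n m : ℕ} (S : Fin m → Finset (Fin n)) : ℕ :=
  Finset.univ.sup fun Y : Finset (Fin n) => disc fun i => S i ∩ Y

/-- The sample space of a random `t`-sparse set system: each element `x ∈ X`
independently gets a uniformly random `t`-element subset `T x ⊆ [m]` of set indices.
The uniform distribution on this finite set is the distribution of the random system. -/
noncomputable def sparseChoices (n m t : ℕ) : Finset (Fin n → Finset (Fin m)) :=
  Finset.univ.filter fun T => ∀ x, (T x).card = t

/-- The set system determined by membership choices `T`: `S_i = {x : i ∈ T x}`. -/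
noncomputable def setsOf {n m : ℕ} (T : Fin n → Finset (Fin m)) : Fin m → Finset (Fin n) :=
  fun i => Finset.univ.filter fun x => i ∈ T x

/-- The signed degree of `i` when each set `A` carries the weight `c A`. -/
def load {m : ℕ} (c : Finset (Fin m) → ℤ) (i : Fin m) : ℤ :=
  ∑ A, if i ∈ A then c A else 0

lemma load_add_single {m : ℕ} (c : Finset (Fin m) → ℤ) (A : Finset (Fin m)) (a : ℤ)
    (i : Fin m) :
    load (c + Pi.single A a) i = load c i + if i ∈ A then a else 0 := by
  have h : ∀ B : Finset (Fin m), (if i ∈ B then (c + Pi.single A a : Finset (Fin m) → ℤ) B else 0)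
      = (if i ∈ B then c B else 0) + if B = A then (if i ∈ A then a else 0) else 0 := by
    intro B
    by_cases hB : B = A
    · subst hB
      by_cases hi : i ∈ B <;> simp [hi]
    · split_ifs <;> simp [hB]
  simp only [load, h, sum_add_distrib, sum_ite_eq', mem_univ, if_true]

lemma sum_add_single {m : ℕ} (c : Finset (Fin m) → ℤ) (A : Finset (Fin m)) (a : ℤ) :
    ∑ B, (c + Pi.single A a : Finset (Fin m) → ℤ) B = ∑ B, c B + a := by
  simp [sum_add_distrib]

lemma sum_load {m t : ℕ} (c : Finset (Fin m) → ℤ) (hc : ∀ A, A.card ≠ t → c A = 0) :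
    ∑ i, load c i = t * ∑ A, c A := by
  simp only [load]
  rw [sum_comm, mul_sum]
  refine sum_congr rfl fun A _ => ?_
  rw [← sum_filter, sum_const, filter_mem_eq_inter, univ_inter, nsmul_eq_mul]
  by_cases h : A.card = t
  · rw [h]
  · rw [hc A h]; simp

lemma card_mul_sum_sq_indicator_sub_le {m t : ℕ} {A B : Finset (Fin m)} (hA : A.card = t)
    (hB : B.card = t) :
    (m : ℤ) * ∑ i, ((if i ∈ A then 1 else 0) - (if i ∈ B then 1 else 0) : ℤ) ^ 2
      ≤ 4 * (t * (m - t)) := by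
  have h : ∀ i, ((if i ∈ A then 1 else 0) - (if i ∈ B then 1 else 0) : ℤ) ^ 2
      = (if i ∈ A \ B then 1 else 0) + (if i ∈ B \ A then 1 else 0) := by
    intro i
    by_cases h1 : i ∈ A <;> by_cases h2 : i ∈ B <;> simp [h1, h2]
  simp only [h, sum_add_distrib, sum_ite_mem, univ_inter, sum_const, nsmul_eq_mul, mul_one]
  have e1 := card_sdiff_add_card_inter A B
  have e2 := card_sdiff_add_card_inter B A
  rw [inter_comm] at e2
  have e3 := card_union_add_card_inter A B
  have e4 : (A ∪ B).card ≤ m := by simpa using card_le_univ (A ∪ B)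
  obtain ⟨x, hx⟩ : ∃ x, (A \ B).card = x := ⟨_, rfl⟩
  have hx' : (B \ A).card = x := by omega
  rw [hx, hx']
  have h1 : (x : ℤ) ≤ t := by omega
  have h2 : (x : ℤ) ≤ m - t := by omega
  have h0 : (0 : ℤ) ≤ x := by omega
  nlinarith [mul_nonneg (h0.trans h1) (sub_nonneg.2 h2), mul_nonneg (h0.trans h2) (sub_nonneg.2 h1)]

lemma exists_balanced_signs_of_even {m t : ℕ} (k : ℕ) : ∀ F : Finset (Finset (Fin m)),
    F.card = 2 * k → (∀ A ∈ F, A.card = t) →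
    ∃ c : Finset (Fin m) → ℤ, (∀ A ∈ F, c A = 1 ∨ c A = -1) ∧ (∀ A ∉ F, c A = 0) ∧
      ∑ A, c A = 0 ∧ (m : ℤ) * ∑ i, load c i ^ 2 ≤ 4 * k * (t * (m - t)) := by
  induction k with
  | zero =>
    intro F hF _
    have : F = ∅ := by simpa using hF
    subst this
    exact ⟨0, by simp, by simp, by simp, by simp [load]⟩
  | succ k ih =>
    intro F hF ht
    obtain ⟨A, F₁, hA, rfl, hF₁⟩ := card_eq_succ.1 (show F.card = (2 * k + 1) + 1 by omega)
    obtain ⟨B, F₂, hB, rfl, hF₂⟩ := card_eq_succ.1 hF₁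
    obtain ⟨c, hc1, hc0, hcs, hcb⟩ := ih F₂ hF₂ fun D hD => ht D (by simp [hD])
    have hAB : A ≠ B := by rintro rfl; simp at hA
    have hA2 : A ∉ F₂ := fun h => hA (by simp [h])
    have key : ∀ ε : ℤ, (ε = 1 ∨ ε = -1) →
        ε * ∑ i, load c i * ((if i ∈ A then 1 else 0) - (if i ∈ B then 1 else 0)) ≤ 0 →
        ∃ c : Finset (Fin m) → ℤ,
          (∀ D ∈ insert A (insert B F₂), c D = 1 ∨ c D = -1) ∧
          (∀ D ∉ insert A (insert B F₂), c D = 0) ∧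
          ∑ D, c D = 0 ∧ (m : ℤ) * ∑ i, load c i ^ 2 ≤ 4 * (k + 1 : ℕ) * (t * (m - t)) := by
      intro ε hε hneg
      refine ⟨c + Pi.single A ε + Pi.single B (-ε), ?_, ?_, ?_, ?_⟩
      · intro D hD
        rw [mem_insert, mem_insert] at hD
        rcases hD with rfl | rfl | hD
        · simp [hAB, hc0 _ hA2, hε]
        · simp [hAB.symm, hc0 _ hB]
          omega
        · have h1 : D ≠ A := by rintro rfl; exact hA2 hD
          have h2 : D ≠ B := by rintro rfl; exact hB hD
          simpa [h1, h2] using hc1 D hD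
      · intro D hD
        simp only [mem_insert, not_or] at hD
        simp [hD.1, hD.2.1, hc0 D hD.2.2]
      · rw [sum_add_single, sum_add_single, hcs]; ring
      · have hε2 : ε ^ 2 = 1 := by rcases hε with rfl | rfl <;> norm_num
        have e : ∀ i, load (c + Pi.single A ε + Pi.single B (-ε)) i ^ 2 = load c i ^ 2
            + 2 * (ε * (load c i * ((if i ∈ A then 1 else 0) - (if i ∈ B then 1 else 0))))
            + ((if i ∈ A then 1 else 0) - (if i ∈ B then 1 else 0) : ℤ) ^ 2 := by
          intro i
          rw [load_add_single, load_add_single]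
          split_ifs <;> first | linear_combination hε2 | ring
        simp only [e, sum_add_distrib, ← mul_sum]
        have := card_mul_sum_sq_indicator_sub_le (ht A (by simp)) (ht B (by simp))
        push_cast
        nlinarith [mul_nonneg (Int.natCast_nonneg m) (neg_nonneg.2 hneg)]
    rcases le_total (∑ i, load c i * ((if i ∈ A then 1 else 0) - (if i ∈ B then 1 else 0))) 0
      with h | h
    · exact key 1 (Or.inl rfl) (by simpa using h)
    · exact key (-1) (Or.inr rfl) (by simpa using h)

lemma exists_balanced_signs {m t : ℕ} (F : Finset (Finset (Fin m))) (ht : ∀ A ∈ F, A.card = t)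
    (htm : t ≤ m) :
    ∃ c : Finset (Fin m) → ℤ, (∀ A ∈ F, c A = 1 ∨ c A = -1) ∧ (∀ A ∉ F, c A = 0) ∧
      (∑ A, c A = 0 ∨ ∑ A, c A = 1) ∧
      ∃ w : Fin m → ℤ, (∀ i, load c i = w i ∨ load c i = w i + 1) ∧
        (m : ℤ) * ∑ i, w i ^ 2 ≤ 2 * F.card * (t * (m - t)) := by
  rcases Nat.even_or_odd' F.card with ⟨k, hk | hk⟩
  · obtain ⟨c, h1, h0, hs, hb⟩ := exists_balanced_signs_of_even k F hk ht
    refine ⟨c, h1, h0, Or.inl hs, load c, fun i => Or.inl rfl, hb.trans_eq ?_⟩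
    rw [hk]; push_cast; ring
  · obtain ⟨A, F', hA, rfl, hF'⟩ := card_eq_succ.1 hk
    obtain ⟨c, h1, h0, hs, hb⟩ :=
      exists_balanced_signs_of_even k F' hF' fun D hD => ht D (by simp [hD])
    refine ⟨c + Pi.single A 1, ?_, ?_, Or.inr (by rw [sum_add_single, hs]; rfl), load c, ?_, ?_⟩
    · intro D hD
      rcases mem_insert.1 hD with rfl | hD
      · simp [h0 _ hA]
      · have : D ≠ A := fun h => hA (h ▸ hD)
        simpa [this] using h1 D hD
    · intro D hD
      simp only [mem_insert, not_or] at hD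
      simp [hD.1, h0 D hD.2]
    · intro i
      rw [load_add_single]
      split_ifs <;> simp
    · have : (0 : ℤ) ≤ t * (m - t) := mul_nonneg (by simp) (by omega)
      rw [hk]; push_cast; nlinarith

lemma exists_insert_notMem_insert_notMem {m t : ℕ} (U : Finset (Finset (Fin m))) {a b : Fin m}
    (hab : a ≠ b) (ht : 1 ≤ t) (hU : U.card < (m - 2).choose (t - 1)) :
    ∃ R : Finset (Fin m), a ∉ R ∧ b ∉ R ∧ (insert a R).card = t ∧ (insert b R).card = t ∧
      insert a R ∉ U ∧ insert b R ∉ U := by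
  by_contra! hcon
  have hcard : (powersetCard (t - 1) (univ \ {a, b})).card = (m - 2).choose (t - 1) := by
    rw [card_powersetCard, card_sdiff_of_subset (subset_univ _), card_pair hab, card_univ,
      Fintype.card_fin]
  have hle : (powersetCard (t - 1) (univ \ {a, b})).card ≤ U.card := by
    have hR : ∀ R ∈ powersetCard (t - 1) (univ \ {a, b}), R.card = t - 1 ∧ a ∉ R ∧ b ∉ R := by
      intro R hR
      rw [mem_powersetCard] at hR
      refine ⟨hR.2, fun h => ?_, fun h => ?_⟩
      · simpa using hR.1 h
      · simpa using hR.1 h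
    refine card_le_card_of_injOn (fun R => if insert a R ∈ U then insert a R else insert b R) ?_ ?_
    · intro R h
      obtain ⟨h1, h2, h3⟩ := hR R h
      by_cases hU' : insert a R ∈ U
      · simp [hU']
      · have := hcon R h2 h3 (by rw [card_insert_of_notMem h2]; omega)
          (by rw [card_insert_of_notMem h3]; omega) hU'
        simpa [hU'] using this
    · have hinv : ∀ R ∈ powersetCard (t - 1) (univ \ {a, b}),
          (if insert a R ∈ U then insert a R else insert b R) \ {a, b} = R := by
        intro R h
        obtain ⟨h1, h2, h3⟩ := hR R h
        ext x
        have : x ∈ R → x ≠ a ∧ x ≠ b := fun hx => ⟨by rintro rfl; exact h2 hx, by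
          rintro rfl; exact h3 hx⟩
        split_ifs <;> simp only [mem_sdiff, mem_insert, mem_singleton] <;> tauto
      intro R h R' h' heq
      rw [← hinv R h, ← hinv R' h']
      exact congrArg (· \ {a, b}) heq
  omega

lemma exists_load_natAbs_le_two {m t : ℕ} (ht : 1 ≤ t) (htm : t < m) (E : ℕ) :
    ∀ (c : Finset (Fin m) → ℤ) (U : Finset (Finset (Fin m))),
      (∀ A, A.card ≠ t → c A = 0) → (∀ A, (c A).natAbs ≤ 3) → (∀ A ∉ U, (c A).natAbs ≤ 1) →
      (∑ A, c A = 0 ∨ ∑ A, c A = 1) → ∑ i, ((load c i).natAbs - 2) = E →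
      2 * E + U.card < (m - 2).choose (t - 1) →
      ∃ c' : Finset (Fin m) → ℤ, (∀ A, A.card ≠ t → c' A = 0) ∧ (∀ A, (c' A).natAbs ≤ 3) ∧
        (∀ A, 2 ∣ c' A - c A) ∧ ∀ i, (load c' i).natAbs ≤ 2 := by
  induction E using Nat.strong_induction_on with
  | _ E ih =>
  intro c U hsupp h3 hU hs hE hlt
  by_cases hdone : ∀ i, (load c i).natAbs ≤ 2
  · exact ⟨c, hsupp, h3, by simp, hdone⟩
  have key : ∀ a b, a ≠ b → (load c a - 2).natAbs - 2 ≤ (load c a).natAbs - 2 →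
      (load c b + 2).natAbs - 2 ≤ (load c b).natAbs - 2 →
      ((load c a - 2).natAbs - 2 < (load c a).natAbs - 2 ∨
        (load c b + 2).natAbs - 2 < (load c b).natAbs - 2) →
      ∃ c' : Finset (Fin m) → ℤ, (∀ A, A.card ≠ t → c' A = 0) ∧ (∀ A, (c' A).natAbs ≤ 3) ∧
        (∀ A, 2 ∣ c' A - c A) ∧ ∀ i, (load c' i).natAbs ≤ 2 := by
    intro a b hab ha hb hstrict
    obtain ⟨R, haR, hbR, hca, hcb, haU, hbU⟩ :=
      exists_insert_notMem_insert_notMem U hab ht (by omega)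
    obtain ⟨A, hA⟩ : ∃ A, insert a R = A := ⟨_, rfl⟩
    obtain ⟨B, hB⟩ : ∃ B, insert b R = B := ⟨_, rfl⟩
    have hAB : A ≠ B := by
      rintro rfl
      have : a ∈ insert b R := hB ▸ hA ▸ mem_insert_self a R
      simp [hab, haR] at this
    rw [hA] at hca haU
    rw [hB] at hcb hbU
    obtain ⟨c', hc'⟩ : ∃ c', c' = c + Pi.single A (-2) + Pi.single B 2 := ⟨_, rfl⟩
    have hcA : c' A = c A - 2 := by simp [hc', hAB]; ring
    have hcB : c' B = c B + 2 := by simp [hc', hAB.symm]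
    have hcD : ∀ D, D ≠ A → D ≠ B → c' D = c D := fun D h1 h2 => by simp [hc', h1, h2]
    have hload : ∀ i, load c' i = load c i - (if i = a then 2 else 0) + if i = b then 2 else 0 := by
      intro i
      rw [hc', load_add_single, load_add_single, ← hA, ← hB]
      by_cases h1 : i = a
      · subst h1; simp [hab, haR]; ring
      by_cases h2 : i = b
      · subst h2; simp [hab.symm, hbR]
      by_cases h4 : i ∈ R <;> simp [h1, h2, h4]
    have hla : load c' a = load c a - 2 := by simp [hload, hab]
    have hlb : load c' b = load c b + 2 := by simp [hload, hab.symm]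
    have hE' : ∑ i, ((load c' i).natAbs - 2) < ∑ i, ((load c i).natAbs - 2) := by
      refine sum_lt_sum (fun i _ => ?_) ?_
      · by_cases h1 : i = a
        · rwa [h1, hla]
        by_cases h2 : i = b
        · rwa [h2, hlb]
        simp [hload, h1, h2]
      · rcases hstrict with h | h
        · exact ⟨a, mem_univ _, by rwa [hla]⟩
        · exact ⟨b, mem_univ _, by rwa [hlb]⟩
    have hA1 := hU A haU
    have hB1 := hU B hbU
    obtain ⟨c'', k1, k2, k3, k4⟩ := ih _ (hE ▸ hE') c' (insert A (insert B U))
      (by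
        intro D hD
        rw [hcD D (by rintro rfl; exact hD hca) (by rintro rfl; exact hD hcb), hsupp D hD])
      (by
        intro D
        by_cases h1 : D = A
        · rw [h1, hcA]; omega
        by_cases h2 : D = B
        · rw [h2, hcB]; omega
        rw [hcD D h1 h2]; exact h3 D)
      (by
        intro D hD
        simp only [mem_insert, not_or] at hD
        rw [hcD D hD.1 hD.2.1]
        exact hU D hD.2.2)
      (by
        rw [hc', sum_add_single, sum_add_single]
        simpa using hs)
      rfl
      (by
        have := card_insert_le A (insert B U)
        have := card_insert_le B U
        omega)
    refine ⟨c'', k1, k2, fun D => ?_, k4⟩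
    have := k3 D
    by_cases h1 : D = A
    · subst h1; rw [hcA] at this; omega
    by_cases h2 : D = B
    · subst h2; rw [hcB] at this; omega
    rwa [hcD D h1 h2] at this
  push Not at hdone
  obtain ⟨i, hi⟩ := hdone
  have hsum := sum_load c hsupp
  have hsum0 : (0 : ℤ) ≤ ∑ i, load c i ∧ ∑ i, load c i < m := by
    rw [hsum]
    rcases hs with h | h <;> rw [h] <;> constructor <;> omega
  rcases le_total 0 (load c i) with hpos | hneg
  · obtain ⟨j, hj⟩ : ∃ j, load c j ≤ 0 := by
      by_contra! h
      have : ∑ _j : Fin m, (1 : ℤ) ≤ ∑ j, load c j := sum_le_sum fun j _ => h j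
      simp at this
      omega
    exact key i j (by rintro rfl; omega) (by omega) (by omega) (Or.inl (by omega))
  · obtain ⟨j, hj⟩ : ∃ j, 0 ≤ load c j := by
      by_contra! h
      have : ∑ j, load c j < ∑ _j : Fin m, (0 : ℤ) :=
        sum_lt_sum (fun j _ => (h j).le) ⟨i, mem_univ _, h i⟩
      simp at this
      omega
    exact key j i (by rintro rfl; omega) (by omega) (by omega) (Or.inr (by omega))

lemma choose_mul_mul_sub {m t : ℕ} (ht : 1 ≤ t) (htm : t < m) :
    m.choose t * (t * (m - t)) = m * (m - 1) * (m - 2).choose (t - 1) := by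
  obtain ⟨s, rfl⟩ : ∃ s, t = s + 1 := ⟨t - 1, by omega⟩
  obtain ⟨k, rfl⟩ : ∃ k, m = k + 2 := ⟨m - 2, by omega⟩
  have h1 := Nat.add_one_mul_choose_eq (k + 1) s
  have h2 := Nat.choose_mul_succ_eq k s
  have e1 : k + 2 - (s + 1) = k + 1 - s := by omega
  have e2 : k + 2 - 1 = k + 1 := rfl
  have e3 : k + 2 - 2 = k := rfl
  rw [e1, e2, e3, Nat.add_sub_cancel, ← mul_assoc, ← h1, mul_assoc, ← h2]
  ring

lemma choose_le_choose_of_le_of_le_half {n a b : ℕ} (hab : a ≤ b) (hb : b ≤ n / 2) :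
    n.choose a ≤ n.choose b := by
  induction b, hab using Nat.le_induction with
  | base => rfl
  | succ b _ ih => exact (ih (by omega)).trans (Nat.choose_le_succ_of_lt_half_left (by omega))

lemma choose_le_choose_of_le_of_add_le {n a b : ℕ} (hab : a ≤ b) (hb : a + b ≤ n) :
    n.choose a ≤ n.choose b := by
  rcases le_or_gt b (n / 2) with h | h
  · exact choose_le_choose_of_le_of_le_half hab h
  · rw [← Nat.choose_symm (show b ≤ n by omega)]
    exact choose_le_choose_of_le_of_le_half (by omega) (by omega)

lemma eight_mul_sq_lt_choose {m t : ℕ} (hm : 100 ≤ m) (ht : 4 ≤ t) (htm : t + 4 ≤ m) :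
    8 * m ^ 2 < (m - 2).choose (t - 1) := by
  refine lt_of_lt_of_le ?_
    (choose_le_choose_of_le_of_add_le (show 3 ≤ t - 1 by omega) (by omega))
  obtain ⟨k, rfl⟩ : ∃ k, m = k + 4 := ⟨m - 4, by omega⟩
  have h := Nat.descFactorial_eq_factorial_mul_choose (k + 2) 3
  simp only [Nat.descFactorial, Nat.factorial] at h
  have e : k + 4 - 2 = k + 2 := rfl
  have e1 : k + 2 - 2 = k := rfl
  have e2 : k + 2 - 1 = k + 1 := rfl
  rw [e1, e2] at h
  rw [e]
  have h1 := Nat.mul_le_mul_right (k * k) (show 96 ≤ k by omega)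
  have h2 := Nat.mul_le_mul_right k (show 96 ≤ k by omega)
  norm_num at h
  nlinarith

/-- Weights on the `t`-subsets with prescribed parities, all of absolute value at most `3`, that
give every point a total weight of absolute value at most `2`. -/
lemma exists_weights {m t : ℕ} (hm : 100 ≤ m) (ht : 4 ≤ t) (htm : t + 4 ≤ m)
    (p : Finset (Fin m) → ℕ) :
    ∃ c : Finset (Fin m) → ℤ, (∀ A, A.card ≠ t → c A = 0) ∧ (∀ A, (c A).natAbs ≤ 3) ∧
      (∀ A, A.card = t → 2 ∣ c A - p A) ∧ ∀ i, (load c i).natAbs ≤ 2 := by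
  obtain ⟨F, hF⟩ : ∃ F, F = (powersetCard t (univ : Finset (Fin m))).filter fun A => p A % 2 = 1 :=
    ⟨_, rfl⟩
  have hmem : ∀ A, A ∈ F ↔ A.card = t ∧ p A % 2 = 1 := by simp [hF, mem_powersetCard]
  have hFc : F.card ≤ m.choose t := by
    rw [hF]
    exact (card_filter_le _ _).trans (by simp)
  obtain ⟨c, h1, h0, hs, w, hw, hb⟩ :=
    exists_balanced_signs F (fun A hA => ((hmem A).1 hA).1) (by omega : t ≤ m)
  have hW := eight_mul_sq_lt_choose hm ht htm
  have hid := choose_mul_mul_sub (show 1 ≤ t by omega) (show t < m by omega)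
  obtain ⟨W, hWdef⟩ : ∃ W, (m - 2).choose (t - 1) = W := ⟨_, rfl⟩
  rw [hWdef] at hW hid
  have hE : 2 * ∑ i, ((load c i).natAbs - 2) < W := by
    have hcs : ((∑ i, (w i).natAbs : ℕ) : ℤ) ^ 2 ≤ m * ∑ i, w i ^ 2 := by
      have := sq_sum_le_card_mul_sum_sq (s := univ) (f := fun i => |w i|)
      simpa using this
    have hid' : (m.choose t : ℤ) * (t * (m - t)) = m * (m - 1) * W := by
      zify [show t ≤ m by omega, show 1 ≤ m by omega] at hid
      exact hid
    have hpos : (0 : ℤ) ≤ t * (m - t) := mul_nonneg (by simp) (by omega)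
    have hFc' : (F.card : ℤ) ≤ m.choose t := by exact_mod_cast hFc
    zify at hW
    obtain ⟨E, hE⟩ : ∃ E, ∑ i, ((load c i).natAbs - 2) = E := ⟨_, rfl⟩
    rw [hE]
    obtain ⟨V, hV⟩ : ∃ V, ∑ i, (w i).natAbs = V := ⟨_, rfl⟩
    rw [hV] at hcs
    have hEV : E ≤ V := by
      rw [← hE, ← hV]
      exact sum_le_sum fun i _ => by rcases hw i with h | h <;> rw [h] <;> omega
    have hVsq : (V : ℤ) ^ 2 ≤ 2 * m ^ 2 * W := by
      have : (2 : ℤ) * F.card * (t * (m - t)) ≤ 2 * (m.choose t * (t * (m - t))) := by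
        nlinarith [mul_le_mul_of_nonneg_right hFc' hpos]
      rw [hid'] at this
      nlinarith [mul_nonneg (Int.natCast_nonneg m) (Int.natCast_nonneg W)]
    have : 2 * (V : ℤ) < W := by
      have hW0 : (0 : ℤ) < W := by nlinarith [sq_nonneg (m : ℤ)]
      refine lt_of_pow_lt_pow_left₀ 2 hW0.le ?_
      nlinarith
    omega
  obtain ⟨c', k1, k2, k3, k4⟩ := exists_load_natAbs_le_two (show 1 ≤ t by omega)
    (show t < m by omega) _ c ∅ (fun A hA => h0 A fun h => hA ((hmem A).1 h).1)
    (fun A => by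
      by_cases hA : A ∈ F
      · rcases h1 A hA with h | h <;> simp [h]
      · simp [h0 A hA])
    (fun A _ => by
      by_cases hA : A ∈ F
      · rcases h1 A hA with h | h <;> simp [h]
      · simp [h0 A hA])
    hs rfl (by simpa [hWdef] using hE)
  refine ⟨c', k1, k2, fun A hA => ?_, k4⟩
  have := k3 A
  by_cases hAF : A ∈ F
  · have hp := ((hmem A).1 hAF).2
    rcases h1 A hAF with h | h <;> rw [h] at this <;> omega
  · have hp : p A % 2 ≠ 1 := fun h => hAF ((hmem A).2 ⟨hA, h⟩)
    rw [h0 A hAF] at this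
    omega

lemma exists_signs_sum_eq {α : Type*} (S : Finset α) {c : ℤ} (hc : c.natAbs ≤ S.card)
    (h2 : 2 ∣ c - S.card) :
    ∃ χ : α → ℤ, (∀ x, χ x = 1 ∨ χ x = -1) ∧ ∑ x ∈ S, χ x = c := by
  obtain ⟨P, hPS, hP⟩ := exists_subset_card_eq (s := S) (n := ((c + S.card) / 2).toNat) (by omega)
  refine ⟨fun x => if x ∈ P then 1 else -1, fun x => ?_, ?_⟩
  · by_cases h : x ∈ P <;> simp [h]
  · rw [← sum_sdiff hPS, sum_congr rfl (g := fun _ => (-1 : ℤ)) fun x hx => by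
      simp [(mem_sdiff.1 hx).2], sum_congr (s₁ := P) rfl (g := fun _ => (1 : ℤ)) fun x hx => by
      simp [hx]]
    have := card_sdiff_add_card_eq_card hPS
    simp only [sum_const, nsmul_eq_mul]
    omega

lemma disc_setsOf_le_two {n m t : ℕ} (hm : 100 ≤ m) (ht : 4 ≤ t) (htm : t + 4 ≤ m)
    (T : Fin n → Finset (Fin m)) (hT : ∀ x, (T x).card = t)
    (h3 : ∀ A : Finset (Fin m), A.card = t → 3 ≤ (univ.filter fun x => T x = A).card) :
    disc (setsOf T) ≤ 2 := by
  obtain ⟨c, hc0, hc3, hcp, hload⟩ :=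
    exists_weights hm ht htm fun A => (univ.filter fun x => T x = A).card
  have hex : ∀ A, ∃ χ : Fin n → ℤ, (∀ x, χ x = 1 ∨ χ x = -1) ∧
      ∑ x ∈ univ.filter fun x => T x = A, χ x = c A := by
    intro A
    by_cases hA : A.card = t
    · exact exists_signs_sum_eq _ ((hc3 A).trans (h3 A hA)) (hcp A hA)
    · refine ⟨fun _ => 1, by simp, ?_⟩
      rw [hc0 A hA, filter_false_of_mem (fun x _ => by rintro rfl; exact hA (hT x)), sum_empty]
  choose χ hχ hsum using hex
  refine Nat.sInf_le ⟨fun x => χ (T x) x, fun x => hχ _ x, fun i => ?_⟩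
  convert hload i using 2
  rw [setsOf, load, ← sum_fiberwise (s := univ.filter fun x => i ∈ T x) (g := T)]
  refine sum_congr rfl fun A _ => ?_
  by_cases hi : i ∈ A
  · rw [if_pos hi, ← hsum A, filter_filter]
    refine sum_congr ?_ fun x hx => ?_
    · ext x
      simp only [mem_filter, mem_univ, true_and]
      exact ⟨fun h => h.2, fun h => ⟨h ▸ hi, h⟩⟩
    · rw [(mem_filter.1 hx).2]
  · rw [if_neg hi, filter_filter, filter_false_of_mem, sum_empty]
    rintro x - ⟨h1, rfl⟩
    exact hi h1

lemma card_filter_forall_ne {n m t : ℕ} (B : Finset (Fin n)) (A : Finset (Fin m))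
    (hA : A.card = t) :
    ((sparseChoices n m t).filter fun T => ∀ x ∈ B, T x ≠ A).card
      = (m.choose t - 1) ^ B.card * m.choose t ^ (n - B.card) := by
  have h : (sparseChoices n m t).filter (fun T => ∀ x ∈ B, T x ≠ A)
      = Fintype.piFinset fun x => if x ∈ B then (powersetCard t univ).erase A
          else powersetCard t univ := by
    ext T
    simp only [sparseChoices, mem_filter, mem_univ, true_and, Fintype.mem_piFinset]
    rw [← forall_and]
    refine forall_congr' fun x => ?_
    by_cases hx : x ∈ B <;> simp [hx, mem_powersetCard, and_comm]
  rw [h, Fintype.card_piFinset]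
  have e : ∀ x, (if x ∈ B then (powersetCard t (univ : Finset (Fin m))).erase A
      else powersetCard t univ).card = if x ∈ B then m.choose t - 1 else m.choose t := by
    intro x
    split_ifs
    · rw [card_erase_of_mem (by simp [mem_powersetCard, hA])]
      simp
    · simp
  simp only [e]
  rw [prod_ite, prod_const, prod_const, filter_mem_eq_inter, univ_inter, filter_notMem_eq_sdiff,
    card_sdiff_of_subset (subset_univ _), card_univ, Fintype.card_fin]

lemma card_sparseChoices (n m t : ℕ) : (sparseChoices n m t).card = m.choose t ^ n := by
  have h : sparseChoices n m t = Fintype.piFinset fun _ => powersetCard t univ := by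
    ext T
    simp [sparseChoices, mem_powersetCard]
  rw [h, Fintype.card_piFinset]
  simp

/-- If some set is attained fewer than three times, then it is missed entirely on one of any three
disjoint blocks of points. -/
lemma card_filter_exists_card_lt_three_le {n m t q : ℕ} (hq : 3 * q ≤ n) :
    ((sparseChoices n m t).filter fun T => ∃ A : Finset (Fin m), A.card = t ∧
      (univ.filter fun x => T x = A).card < 3).card
      ≤ 3 * m.choose t * ((m.choose t - 1) ^ q * m.choose t ^ (n - q)) := by
  obtain ⟨B, hB⟩ : ∃ B : Fin 3 → Finset (Fin n), ∀ k, B k =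
      (univ : Finset (Fin q)).image fun l => ⟨3 * l + k, by omega⟩ := ⟨_, fun _ => rfl⟩
  have hBc : ∀ k, (B k).card = q := by
    intro k
    rw [hB, card_image_of_injective]
    · simp
    · intro l l' h
      simp only [Fin.mk.injEq] at h
      exact Fin.ext (by omega)
  have hBmod : ∀ k, ∀ x ∈ B k, x.val % 3 = k := by
    intro k x hx
    rw [hB, mem_image] at hx
    obtain ⟨l, -, rfl⟩ := hx
    simp only
    omega
  have hsub : ((sparseChoices n m t).filter fun T => ∃ A : Finset (Fin m), A.card = t ∧
      (univ.filter fun x => T x = A).card < 3) ⊆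
      ((univ : Finset (Fin 3)) ×ˢ powersetCard t (univ : Finset (Fin m))).biUnion fun kA =>
        (sparseChoices n m t).filter fun T => ∀ x ∈ B kA.1, T x ≠ kA.2 := by
    intro T hT
    obtain ⟨hTs, A, hA, hlt⟩ := mem_filter.1 hT
    by_contra hcon
    have hx : ∀ k, ∃ x ∈ B k, T x = A := by
      intro k
      by_contra! h
      refine hcon (mem_biUnion.2 ⟨(k, A), ?_, mem_filter.2 ⟨hTs, h⟩⟩)
      simp [mem_powersetCard, hA]
    choose x hxB hxA using hx
    have hinj : Function.Injective x := by
      intro k k' h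
      have h1 := hBmod k _ (hxB k)
      have h2 := hBmod k' _ (hxB k')
      rw [h] at h1
      exact Fin.ext (h1.symm.trans h2)
    have : (univ.image x).card ≤ (univ.filter fun x => T x = A).card :=
      card_le_card fun y hy => by
        obtain ⟨k, -, rfl⟩ := mem_image.1 hy
        simp [hxA]
    rw [card_image_of_injective _ hinj] at this
    simp at this
    omega
  refine (card_le_card hsub).trans ((card_biUnion_le_card_mul _ _
    ((m.choose t - 1) ^ q * m.choose t ^ (n - q)) fun kA h => ?_).trans_eq ?_)
  · rw [card_filter_forall_ne _ _ (mem_powersetCard.1 (mem_product.1 h).2).2, hBc]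
  · rw [card_product, card_powersetCard]
    simp

/-- The numerical estimate behind the coupon collector argument. -/
lemma coupon_collector_bound {N n q : ℕ} (hN : 9 ≤ N) (hq : q = n / 3)
    (hn : 9 * (N : ℝ) * Real.log N ≤ n) :
    3 * (N : ℝ) * (((N : ℝ) - 1) ^ q * (N : ℝ) ^ (n - q)) ≤ 1 / N * (N : ℝ) ^ n := by
  have hN0 : (0 : ℝ) < N := by positivity
  have hN9 : (9 : ℝ) ≤ N := by exact_mod_cast hN
  have hsplit : (N : ℝ) ^ n = (N : ℝ) ^ q * (N : ℝ) ^ (n - q) := by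
    rw [← pow_add]; congr 1; omega
  have hexp : ((N : ℝ) - 1) ^ q ≤ (N : ℝ) ^ q * (3 / (N : ℝ) ^ 3) := by
    have h1 : (N : ℝ) - 1 ≤ N * Real.exp (-(1 / N)) := by
      have := Real.add_one_le_exp (-(1 / (N : ℝ)))
      calc (N : ℝ) - 1 = N * (-(1 / N) + 1) := by field_simp; ring
        _ ≤ _ := by gcongr
    have h2 : Real.exp (-(1 / (N : ℝ))) ^ q ≤ 3 / (N : ℝ) ^ 3 := by
      have hqn : (n : ℝ) / 3 - 1 ≤ q := by
        have : n ≤ 3 * q + 2 := by omega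
        have : (n : ℝ) ≤ 3 * q + 2 := by exact_mod_cast this
        linarith
      have hle : (q : ℝ) * -(1 / N) ≤ 1 - 3 * Real.log N := by
        have : (3 * N * Real.log N - N) / N ≤ (q : ℝ) / N := by
          gcongr
          nlinarith
        have e : (3 * N * Real.log N - N) / N = 3 * Real.log N - 1 := by field_simp
        rw [e] at this
        have e2 : (q : ℝ) * -(1 / N) = -(q / N) := by ring
        rw [e2]
        linarith
      rw [← Real.exp_nat_mul]
      refine (Real.exp_le_exp.2 hle).trans ?_
      have e3 : Real.exp (3 * Real.log N) = (N : ℝ) ^ 3 := by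
        rw [← Real.log_rpow hN0, Real.exp_log (by positivity)]
        norm_cast
      rw [Real.exp_sub, e3]
      gcongr
      exact Real.exp_one_lt_d9.le.trans (by norm_num)
    calc ((N : ℝ) - 1) ^ q ≤ (N * Real.exp (-(1 / N))) ^ q := by
          gcongr
          linarith
      _ ≤ _ := by
          rw [mul_pow]
          gcongr
  calc 3 * (N : ℝ) * (((N : ℝ) - 1) ^ q * (N : ℝ) ^ (n - q))
      ≤ 3 * (N : ℝ) * ((N : ℝ) ^ q * (3 / (N : ℝ) ^ 3) * (N : ℝ) ^ (n - q)) := by gcongr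
    _ = 9 / N * (1 / N * (N : ℝ) ^ n) := by rw [hsplit]; field_simp; ring
    _ ≤ 1 * (1 / N * (N : ℝ) ^ n) := by
        gcongr
        rw [div_le_one hN0]; exact hN9
    _ = _ := one_mul _

/-- For `m ≥ m₀`, `4 ≤ t ≤ m - 4`, `N = C(m,t)` and `n ≥ C·N·log N`, a random
`t`-sparse set system has `disc(Σ) ≤ 2` with probability at least `1 - 1/N`. -/
theorem random_disc_le_two_whp :
    ∃ C : ℝ, 0 < C ∧ ∃ m₀ : ℕ, ∀ m t n : ℕ, m₀ ≤ m → 4 ≤ t → t + 4 ≤ m →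
      C * (m.choose t : ℝ) * Real.log (m.choose t) ≤ (n : ℝ) →
      1 - 1 / (m.choose t : ℝ) ≤
        (((sparseChoices n m t).filter fun T => disc (setsOf T) ≤ 2).card : ℝ)
          / (sparseChoices n m t).card := by
  refine ⟨9, by norm_num, 100, fun m t n hm ht htm hn => ?_⟩
  have hN : 9 ≤ m.choose t := by
    have := choose_le_choose_of_le_of_add_le (show 1 ≤ t by omega) (show 1 + t ≤ m by omega)
    rw [Nat.choose_one_right] at this
    omega
  have hN0 : (0 : ℝ) < m.choose t := by
    have : 0 < m.choose t := by omega
    exact_mod_cast this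
  have hgood : (sparseChoices n m t).filter (fun T => ¬ disc (setsOf T) ≤ 2) ⊆
      (sparseChoices n m t).filter fun T => ∃ A : Finset (Fin m), A.card = t ∧
        (univ.filter fun x => T x = A).card < 3 := by
    intro T hT
    obtain ⟨hTs, hT2⟩ := mem_filter.1 hT
    refine mem_filter.2 ⟨hTs, ?_⟩
    by_contra! h
    exact hT2 (disc_setsOf_le_two hm ht htm T (mem_filter.1 hTs).2 h)
  have hbad : (((sparseChoices n m t).filter fun T => ¬ disc (setsOf T) ≤ 2).card : ℝ)
      ≤ 1 / m.choose t * (m.choose t : ℝ) ^ n := by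
    refine le_trans ?_ (coupon_collector_bound hN rfl hn)
    have := (card_le_card hgood).trans
      (card_filter_exists_card_lt_three_le (show 3 * (n / 3) ≤ n by omega))
    have hcast := (Nat.cast_le (α := ℝ)).2 this
    push_cast [Nat.cast_sub (show 1 ≤ m.choose t by omega)] at hcast
    exact hcast
  have hsum := card_filter_add_card_filter_not (s := sparseChoices n m t)
    (fun T => disc (setsOf T) ≤ 2)
  rw [card_sparseChoices] at hsum ⊢
  have hsum' := congrArg (Nat.cast (R := ℝ)) hsum
  push_cast at hsum' ⊢
  rw [le_div_iff₀ (by positivity)]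
  linarith
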